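/- (Accuracy of the soft-min MFCG fixed point.) Set L_p^tot = L_p^glob + L_p^loc, L_f^tot = L_f^glob + L_f^loc, and φ_max^tot = ((|𝒳|c_min − L_p^tot)/|𝒜|)·(1−γ)/(L_f^tot + (γ/(1−γ))L_p^tot‖f‖∞). Under Assumption (Lip3), L_p^tot < |𝒳|c_min, and the φ-smallness conditions guaranteeing the fixed points μ'*_{Q,μ}, Q*_μ, μ*φ exist, suppose there exists a triple (μ̂, Q̂, μ̂') with μ̂' = P-invariant for argmin_e Q̂ at (μ̂,μ̂'), Q̂ = B_{μ̂,μ̂'}Q̂, and μ̂ invariant for argmin_e Q̂ at (μ̂,μ̂') (so that μ̂ = μ̂'). Let δ > 0 be the action gap of Q̂, assume φ_max^tot − 1/δ > 0, and take φ = φ_max^tot − 1/δ. Then ‖μ*φ − μ̂‖₁ ≤ (2√|𝒜|·δ·(1−γ)/(L_f^tot + (γ/(1−γ))L_p^tot‖f‖∞))·exp(1 − δ·φ_max^tot) and ‖Q*_{μ*φ} − Q̂‖∞ ≤ 2√|𝒜|·δ·exp(1 − δ·φ_max^tot). -/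

import Mathlib

open Finset Filter
open scoped Classical

noncomputable section

variable {X A : Type*}

/-- A probability vector on a finite set. -/
def IsProb [Fintype X] (μ : X → ℝ) : Prop := (∀ x, 0 ≤ μ x) ∧ ∑ x, μ x = 1

/-- ℓ¹ norm of a signed measure / vector on a finite set. -/
def l1 [Fintype X] (μ : X → ℝ) : ℝ := ∑ x, |μ x|

/-- Sup norm of a Q-table. -/
def supQ [Fintype X] [Fintype A] [Nonempty X] [Nonempty A] (Q : X → A → ℝ) : ℝ :=
  Finset.univ.sup' Finset.univ_nonempty (fun xa : X × A => |Q xa.1 xa.2|)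

/-- Minimum of a row of a Q-table (minimum over actions). -/
def minRow [Fintype A] [Nonempty A] (q : A → ℝ) : ℝ :=
  Finset.univ.inf' Finset.univ_nonempty q

/-- The soft-min distribution over actions with parameter φ. -/
def softmin [Fintype A] (φ : ℝ) (z : A → ℝ) (a : A) : ℝ :=
  Real.exp (-φ * z a) / ∑ a', Real.exp (-φ * z a')

/-- The argmin_e policy: uniform over the minimizers, zero elsewhere. -/
def argminE [Fintype A] [Nonempty A] (q : A → ℝ) (a : A) : ℝ :=
  if q a = minRow q then (1 : ℝ) / (Finset.univ.filter fun a' => q a' = minRow q).card else 0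

/-- (P^{π,μ,μ'} ν)(x) = ∑_{x₁} ν(x₁) ∑_a π(a|x₁) p(x|x₁,a,μ,μ') for a kernel with a
global distribution μ and a local distribution μ'. -/
def Ppush3 [Fintype X] [Fintype A] (p : X → A → (X → ℝ) → (X → ℝ) → X → ℝ)
    (π : X → A → ℝ) (μ μ' ν : X → ℝ) (x : X) : ℝ :=
  ∑ x1, ν x1 * ∑ a, π x1 a * p x1 a μ μ' x

/-- The Bellman operator (B_{μ,μ'} Q)(x,a) = f(x,a,μ,μ') + γ ∑_{x'} p(x'|x,a,μ,μ') min_{a'} Q(x',a'). -/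
def bell3 [Fintype X] [Fintype A] [Nonempty A]
    (f : X → A → (X → ℝ) → (X → ℝ) → ℝ) (p : X → A → (X → ℝ) → (X → ℝ) → X → ℝ)
    (γ : ℝ) (μ μ' : X → ℝ) (Q : X → A → ℝ) (x : X) (a : A) : ℝ :=
  f x a μ μ' + γ * ∑ x', p x a μ μ' x' * minRow (Q x')

lemma aux_sig (p q u t : ℝ) (hp0 : 0 ≤ p) (hp1 : p ≤ 1) (hq0 : 0 ≤ q) (hq1 : q ≤ 1)
    (hu : 0 ≤ u) (ht : t = Real.exp (-u))
    (h : t * t * (p * (1 - q)) ≤ q * (1 - p)) : p - q ≤ u := by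
  by_contra hcon
  push Not at hcon
  have hu1 : u < 1 := by linarith
  have htu : 1 - u ≤ t := by
    rw [ht]; linarith [Real.add_one_le_exp (-u)]
  have hM : 0 ≤ p * (1 - q) := mul_nonneg hp0 (by linarith)
  have h2 : (1 - u) * (1 - u) ≤ t * t := mul_self_le_mul_self (by linarith) htu
  have h3 : (1 - u) * (1 - u) * (p * (1 - q)) ≤ q * (1 - p) :=
    le_trans (mul_le_mul_of_nonneg_right h2 hM) h
  obtain ⟨r, hr⟩ : ∃ r, r = p - q := ⟨_, rfl⟩
  rw [← hr] at hcon
  have hr1 : r ≤ 1 := by linarith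
  have hr0 : 0 < r := by linarith
  have h4 : r ≤ (u * (2 - u)) * (p * (1 - q)) := by rw [hr]; nlinarith
  have h5 : p * (1 - q) ≤ (1 + r) ^ 2 / 4 := by
    rw [hr]; nlinarith [sq_nonneg (p - (1 - q))]
  have h6 : u * (2 - u) < r * (2 - r) := by nlinarith
  have h7 : r ≤ (u * (2 - u)) * ((1 + r) ^ 2 / 4) :=
    le_trans h4 (mul_le_mul_of_nonneg_left h5 (mul_nonneg hu (by linarith)))
  have h8 : (u * (2 - u)) * ((1 + r) ^ 2 / 4) < r * (2 - r) * ((1 + r) ^ 2 / 4) :=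
    mul_lt_mul_of_pos_right h6 (by positivity)
  have h9 : r * (2 - r) * ((1 + r) ^ 2 / 4) = r - r * ((1 - r) ^ 2 * (2 + r)) / 4 := by ring
  have h10 : 0 ≤ r * ((1 - r) ^ 2 * (2 + r)) := by positivity
  linarith

lemma aux_sumexp_pos [Fintype A] [Nonempty A] (φ : ℝ) (z : A → ℝ) :
    0 < ∑ a', Real.exp (-φ * z a') :=
  Finset.sum_pos (fun _ _ => Real.exp_pos _) Finset.univ_nonempty

lemma softmin_nonneg' [Fintype A] [Nonempty A] (φ : ℝ) (z : A → ℝ) (a : A) :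
    0 ≤ softmin φ z a :=
  div_nonneg (Real.exp_pos _).le (aux_sumexp_pos φ z).le

lemma softmin_sum' [Fintype A] [Nonempty A] (φ : ℝ) (z : A → ℝ) :
    ∑ a, softmin φ z a = 1 := by
  unfold softmin
  rw [← Finset.sum_div, div_self (aux_sumexp_pos φ z).ne']

lemma softmin_le_one' [Fintype A] [Nonempty A] (φ : ℝ) (z : A → ℝ) (a : A) :
    softmin φ z a ≤ 1 := by
  rw [← softmin_sum' φ z]
  exact Finset.single_le_sum (f := softmin φ z) (fun b _ => softmin_nonneg' φ z b)
    (Finset.mem_univ a)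

lemma softmin_lip_one [Fintype A] [Nonempty A] (φ : ℝ) (hφ : 0 ≤ φ) (z w : A → ℝ) (d : ℝ)
    (hd : ∀ a, |z a - w a| ≤ d) (a : A) : softmin φ z a - softmin φ w a ≤ φ * d := by
  have hd0 : 0 ≤ d := le_trans (abs_nonneg _) (hd a)
  refine aux_sig _ _ (φ * d) (Real.exp (-(φ * d))) (softmin_nonneg' φ z a) (softmin_le_one' φ z a)
    (softmin_nonneg' φ w a) (softmin_le_one' φ w a) (mul_nonneg hφ hd0) rfl ?_
  have hZ := aux_sumexp_pos φ z
  have hW := aux_sumexp_pos φ w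
  have eZ : ∑ a', Real.exp (-φ * z a') =
      Real.exp (-φ * z a) + ∑ b ∈ univ.erase a, Real.exp (-φ * z b) :=
    (Finset.add_sum_erase _ _ (Finset.mem_univ a)).symm
  have eW : ∑ a', Real.exp (-φ * w a') =
      Real.exp (-φ * w a) + ∑ b ∈ univ.erase a, Real.exp (-φ * w b) :=
    (Finset.add_sum_erase _ _ (Finset.mem_univ a)).symm
  have h1 : Real.exp (-(φ * d)) * Real.exp (-φ * z a) ≤ Real.exp (-φ * w a) := by
    rw [← Real.exp_add]
    apply Real.exp_le_exp.mpr
    have := abs_le.mp (hd a)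
    nlinarith
  have h2 : Real.exp (-(φ * d)) * ∑ b ∈ univ.erase a, Real.exp (-φ * w b)
      ≤ ∑ b ∈ univ.erase a, Real.exp (-φ * z b) := by
    rw [Finset.mul_sum]
    apply Finset.sum_le_sum
    intro b _
    rw [← Real.exp_add]
    apply Real.exp_le_exp.mpr
    have := abs_le.mp (hd b)
    nlinarith
  have hB : 0 ≤ ∑ b ∈ univ.erase a, Real.exp (-φ * w b) :=
    Finset.sum_nonneg (fun _ _ => (Real.exp_pos _).le)
  unfold softmin
  rw [eZ] at hZ ⊢
  rw [eW] at hW ⊢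
  have hx := Real.exp_pos (-φ * z a)
  have hy := Real.exp_pos (-φ * w a)
  have ht := Real.exp_pos (-(φ * d))
  generalize Real.exp (-φ * z a) = x at *
  generalize Real.exp (-φ * w a) = y at *
  generalize Real.exp (-(φ * d)) = t at *
  generalize ∑ b ∈ univ.erase a, Real.exp (-φ * z b) = B at *
  generalize ∑ b ∈ univ.erase a, Real.exp (-φ * w b) = C at *
  have e1 : t * t * (x / (x + B) * (1 - y / (y + C))) = ((t * x) * (t * C)) / ((x + B) * (y + C)) := by
    field_simp
    ring
  have e2 : y / (y + C) * (1 - x / (x + B)) = (y * B) / ((x + B) * (y + C)) := by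
    field_simp
    ring
  rw [e1, e2]
  apply div_le_div_of_nonneg_right _ (mul_pos hZ hW).le
  exact mul_le_mul h1 h2 (by positivity) hy.le

lemma softmin_lip' [Fintype A] [Nonempty A] (φ : ℝ) (hφ : 0 ≤ φ) (z w : A → ℝ) (d : ℝ)
    (hd : ∀ a, |z a - w a| ≤ d) :
    ∑ a, |softmin φ z a - softmin φ w a| ≤ (Fintype.card A : ℝ) * (φ * d) := by
  have : ∀ a ∈ (univ : Finset A), |softmin φ z a - softmin φ w a| ≤ φ * d := by
    intro a _
    have h1 := softmin_lip_one φ hφ z w d hd a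
    have h2 := softmin_lip_one φ hφ w z d (fun a => by rw [abs_sub_comm]; exact hd a) a
    rw [abs_le]; constructor <;> linarith
  refine (Finset.sum_le_sum this).trans ?_
  simp

lemma minRow_le' [Fintype A] [Nonempty A] (q : A → ℝ) (a : A) : minRow q ≤ q a :=
  Finset.inf'_le _ (Finset.mem_univ a)

lemma minRow_mem' [Fintype A] [Nonempty A] (q : A → ℝ) : ∃ a, q a = minRow q := by
  obtain ⟨a, _, h⟩ := Finset.exists_mem_eq_inf' (s := (univ : Finset A)) Finset.univ_nonempty q
  exact ⟨a, h.symm⟩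

lemma minRow_lip' [Fintype A] [Nonempty A] (q r : A → ℝ) (d : ℝ) (h : ∀ a, |q a - r a| ≤ d) :
    |minRow q - minRow r| ≤ d := by
  obtain ⟨a, ha⟩ := minRow_mem' q
  obtain ⟨b, hb⟩ := minRow_mem' r
  have h1 := minRow_le' q b
  have h2 := minRow_le' r a
  have h3 := abs_le.mp (h a)
  have h4 := abs_le.mp (h b)
  rw [abs_le]; constructor <;> linarith

lemma minRow_abs' [Fintype A] [Nonempty A] (q : A → ℝ) (d : ℝ) (h : ∀ a, |q a| ≤ d) :
    |minRow q| ≤ d := by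
  obtain ⟨a, ha⟩ := minRow_mem' q
  rw [← ha]; exact h a

lemma argmin_card_pos [Fintype A] [Nonempty A] (q : A → ℝ) :
    0 < (Finset.univ.filter fun a' => q a' = minRow q).card := by
  obtain ⟨a, ha⟩ := minRow_mem' q
  exact Finset.card_pos.mpr ⟨a, by simp [ha]⟩

lemma argminE_nonneg' [Fintype A] [Nonempty A] (q : A → ℝ) (a : A) : 0 ≤ argminE q a := by
  unfold argminE
  split_ifs
  · positivity
  · exact le_rfl

lemma argminE_sum' [Fintype A] [Nonempty A] (q : A → ℝ) : ∑ a, argminE q a = 1 := by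
  unfold argminE
  rw [← Finset.sum_filter, Finset.sum_const, nsmul_eq_mul]
  have : ((Finset.univ.filter fun a' => q a' = minRow q).card : ℝ) ≠ 0 := by
    exact_mod_cast (argmin_card_pos q).ne'
  field_simp

lemma softmin_argmin' [Fintype A] [Nonempty A] (φ δ : ℝ) (hφ : 0 ≤ φ) (z : A → ℝ)
    (hgap : ∀ a, minRow z < z a → minRow z + δ ≤ z a) :
    ∑ a, |softmin φ z a - argminE z a| ≤ 2 * (Fintype.card A : ℝ) * Real.exp (-(φ * δ)) := by
  have hZ := aux_sumexp_pos φ z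
  have hE := Real.exp_pos (-(φ * δ))
  have hm := Real.exp_pos (-φ * minRow z)
  have hk : (0 : ℝ) < (Finset.univ.filter fun a' => z a' = minRow z).card := by
    exact_mod_cast argmin_card_pos z
  have hZk : ((Finset.univ.filter fun a' => z a' = minRow z).card : ℝ) * Real.exp (-φ * minRow z)
      ≤ ∑ a', Real.exp (-φ * z a') := by
    have : ∑ a' ∈ Finset.univ.filter (fun a' => z a' = minRow z), Real.exp (-φ * z a')
        = ((Finset.univ.filter fun a' => z a' = minRow z).card : ℝ) * Real.exp (-φ * minRow z) := by
      rw [← nsmul_eq_mul, ← Finset.sum_const]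
      apply Finset.sum_congr rfl
      intro b hb
      rw [(Finset.mem_filter.mp hb).2]
    rw [← this]
    exact Finset.sum_le_sum_of_subset_of_nonneg (Finset.filter_subset _ _)
      (fun _ _ _ => (Real.exp_pos _).le)
  have hZ1 : Real.exp (-φ * minRow z) ≤ ∑ a', Real.exp (-φ * z a') := by
    obtain ⟨b, hb⟩ := minRow_mem' z
    rw [← hb]
    exact Finset.single_le_sum (f := fun a' => Real.exp (-φ * z a'))
      (fun _ _ => (Real.exp_pos _).le) (Finset.mem_univ b)
  have key : ∀ a, softmin φ z a - argminE z a ≤ Real.exp (-(φ * δ)) := by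
    intro a
    unfold softmin argminE
    split_ifs with h
    · rw [h]
      have : Real.exp (-φ * minRow z) / ∑ a', Real.exp (-φ * z a')
          ≤ 1 / ((Finset.univ.filter fun a' => z a' = minRow z).card : ℝ) := by
        rw [div_le_div_iff₀ hZ hk]
        linarith
      linarith
    · rw [sub_zero, div_le_iff₀ hZ]
      have hlt : minRow z < z a := lt_of_le_of_ne (minRow_le' z a) (Ne.symm h)
      have hg := hgap a hlt
      have : Real.exp (-φ * z a) ≤ Real.exp (-(φ * δ)) * Real.exp (-φ * minRow z) := by
        rw [← Real.exp_add]
        apply Real.exp_le_exp.mpr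
        nlinarith
      exact this.trans (mul_le_mul_of_nonneg_left hZ1 hE.le)
  have key2 : ∀ a ∈ (univ : Finset A), |softmin φ z a - argminE z a|
      ≤ 2 * Real.exp (-(φ * δ)) - (softmin φ z a - argminE z a) := by
    intro a _
    have := key a
    rw [abs_le]; constructor <;> linarith
  refine (Finset.sum_le_sum key2).trans ?_
  rw [Finset.sum_sub_distrib, Finset.sum_sub_distrib, softmin_sum', argminE_sum']
  simp
  linarith

/-- Dobrushin contraction on mean-zero signed measures. -/
lemma dobrushin' [Fintype X] (K : X → X → ℝ) (c : ℝ) (hK : ∀ x y, c ≤ K x y)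
    (hK1 : ∀ x, ∑ y, K x y = 1) (η : X → ℝ) (hη : ∑ x, η x = 0) :
    ∑ y, |∑ x, η x * K x y| ≤ (1 - (Fintype.card X : ℝ) * c) * ∑ x, |η x| := by
  have h1 : ∀ y ∈ (univ : Finset X), |∑ x, η x * K x y| ≤ ∑ x, |η x| * (K x y - c) := by
    intro y _
    have : ∑ x, η x * K x y = ∑ x, η x * (K x y - c) := by
      simp only [mul_sub, Finset.sum_sub_distrib]
      rw [← Finset.sum_mul, hη]; ring
    rw [this]
    refine (Finset.abs_sum_le_sum_abs _ _).trans (le_of_eq ?_)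
    apply Finset.sum_congr rfl
    intro x _
    rw [abs_mul, abs_of_nonneg (sub_nonneg.mpr (hK x y))]
  refine (Finset.sum_le_sum h1).trans (le_of_eq ?_)
  rw [Finset.sum_comm, Finset.mul_sum]
  apply Finset.sum_congr rfl
  intro x _
  rw [← Finset.mul_sum, Finset.sum_sub_distrib, hK1]
  simp
  ring

lemma mixK_ge [Fintype X] [Fintype A] (π : A → ℝ) (h0 : ∀ a, 0 ≤ π a) (h1 : ∑ a, π a = 1)
    (k : A → ℝ) (c : ℝ) (hk : ∀ a, c ≤ k a) : c ≤ ∑ a, π a * k a := by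
  calc c = ∑ a, π a * c := by rw [← Finset.sum_mul, h1, one_mul]
    _ ≤ _ := Finset.sum_le_sum fun a _ => mul_le_mul_of_nonneg_left (hk a) (h0 a)

lemma mixK_sum [Fintype X] [Fintype A] (π : A → ℝ) (h1 : ∑ a, π a = 1)
    (k : A → X → ℝ) (hk : ∀ a, ∑ y, k a y = 1) : ∑ y, ∑ a, π a * k a y = 1 := by
  rw [Finset.sum_comm]
  simp only [← Finset.mul_sum, hk, mul_one, h1]

/-- Two invariant probability vectors of the same minorised kernel agree. -/
lemma inv_unique' [Fintype X] (K : X → X → ℝ) (c : ℝ) (hK : ∀ x y, c ≤ K x y)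
    (hK1 : ∀ x, ∑ y, K x y = 1) (hc : 0 < (Fintype.card X : ℝ) * c)
    (μ ν : X → ℝ) (hμ : IsProb μ) (hν : IsProb ν)
    (h1 : ∀ y, ∑ x, μ x * K x y = μ y) (h2 : ∀ y, ∑ x, ν x * K x y = ν y) : μ = ν := by
  have h := dobrushin' K c hK hK1 (fun x => μ x - ν x)
    (by rw [Finset.sum_sub_distrib, hμ.2, hν.2, sub_self])
  simp only [sub_mul, Finset.sum_sub_distrib, h1, h2] at h
  have h0 : 0 ≤ ∑ x, |μ x - ν x| := Finset.sum_nonneg fun _ _ => abs_nonneg _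
  have hz : ∑ x, |μ x - ν x| = 0 := by nlinarith
  funext x
  have := (Finset.sum_eq_zero_iff_of_nonneg (fun i _ => abs_nonneg (μ i - ν i))).mp hz x
    (Finset.mem_univ x)
  exact sub_eq_zero.mp (abs_eq_zero.mp this)

/-- Perturbation of the invariant measure. -/
lemma inv_perturb' [Fintype X] [Fintype A] (π ρ : X → A → ℝ) (k l : X → A → X → ℝ)
    (hπ0 : ∀ x a, 0 ≤ π x a) (hπ1 : ∀ x, ∑ a, π x a = 1)
    (c L R : ℝ) (hk : ∀ x a y, c ≤ k x a y) (hk1 : ∀ x a, ∑ y, k x a y = 1)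
    (hl0 : ∀ x a y, 0 ≤ l x a y) (hl1 : ∀ x a, ∑ y, l x a y = 1)
    (μ ν : X → ℝ) (hμ : IsProb μ) (hν : IsProb ν)
    (hkl : ∀ x a, ∑ y, |k x a y - l x a y| ≤ L)
    (hR : ∀ x, ∑ a, |π x a - ρ x a| ≤ R)
    (h1 : ∀ y, ∑ x, μ x * ∑ a, π x a * k x a y = μ y)
    (h2 : ∀ y, ∑ x, ν x * ∑ a, ρ x a * l x a y = ν y) :
    ∑ y, |μ y - ν y| ≤ (1 - (Fintype.card X : ℝ) * c) * ∑ x, |μ x - ν x| + L + R := by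
  have hd := dobrushin' (fun x y => ∑ a, π x a * k x a y) c
    (fun x y => mixK_ge (X := X) (π x) (hπ0 x) (hπ1 x) _ c (fun a => hk x a y))
    (fun x => mixK_sum (π x) (hπ1 x) (k x) (hk1 x)) (fun x => μ x - ν x)
    (by rw [Finset.sum_sub_distrib, hμ.2, hν.2, sub_self])
  have hpt : ∀ y ∈ (univ : Finset X), |μ y - ν y| ≤ |∑ x, (μ x - ν x) * ∑ a, π x a * k x a y|
      + ∑ x, ν x * ∑ a, π x a * |k x a y - l x a y|
      + ∑ x, ν x * ∑ a, |π x a - ρ x a| * l x a y := by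
    intro y _
    have e : μ y - ν y = ∑ x, (μ x - ν x) * ∑ a, π x a * k x a y
      + ∑ x, ν x * ∑ a, π x a * (k x a y - l x a y)
      + ∑ x, ν x * ∑ a, (π x a - ρ x a) * l x a y := by
      conv_lhs => rw [← h1 y, ← h2 y]
      rw [← Finset.sum_sub_distrib, ← Finset.sum_add_distrib, ← Finset.sum_add_distrib]
      apply Finset.sum_congr rfl
      intro x _
      simp only [mul_sub, sub_mul, Finset.sum_sub_distrib]
      ring
    have b1 : |∑ x, ν x * ∑ a, π x a * (k x a y - l x a y)|
        ≤ ∑ x, ν x * ∑ a, π x a * |k x a y - l x a y| := by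
      refine (Finset.abs_sum_le_sum_abs _ _).trans (Finset.sum_le_sum fun x _ => ?_)
      rw [abs_mul, abs_of_nonneg (hν.1 x)]
      refine mul_le_mul_of_nonneg_left ?_ (hν.1 x)
      refine (Finset.abs_sum_le_sum_abs _ _).trans (Finset.sum_le_sum fun a _ => ?_)
      rw [abs_mul, abs_of_nonneg (hπ0 x a)]
    have b2 : |∑ x, ν x * ∑ a, (π x a - ρ x a) * l x a y|
        ≤ ∑ x, ν x * ∑ a, |π x a - ρ x a| * l x a y := by
      refine (Finset.abs_sum_le_sum_abs _ _).trans (Finset.sum_le_sum fun x _ => ?_)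
      rw [abs_mul, abs_of_nonneg (hν.1 x)]
      refine mul_le_mul_of_nonneg_left ?_ (hν.1 x)
      refine (Finset.abs_sum_le_sum_abs _ _).trans (Finset.sum_le_sum fun a _ => ?_)
      rw [abs_mul, abs_of_nonneg (hl0 x a y)]
    rw [e]
    refine (abs_add_le _ _).trans (add_le_add ((abs_add_le _ _).trans ?_) b2)
    linarith
  have s1 : ∑ y, ∑ x, ν x * ∑ a, π x a * |k x a y - l x a y| ≤ L := by
    rw [Finset.sum_comm]
    calc _ = ∑ x, ν x * ∑ a, π x a * ∑ y, |k x a y - l x a y| := by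
          apply Finset.sum_congr rfl
          intro x _
          rw [← Finset.mul_sum, Finset.sum_comm]
          simp only [Finset.mul_sum]
      _ ≤ ∑ x, ν x * ∑ a, π x a * L := by
          refine Finset.sum_le_sum fun x _ => mul_le_mul_of_nonneg_left ?_ (hν.1 x)
          exact Finset.sum_le_sum fun a _ => mul_le_mul_of_nonneg_left (hkl x a) (hπ0 x a)
      _ = L := by
          simp only [← Finset.sum_mul, hπ1, hν.2, one_mul]
  have s2 : ∑ y, ∑ x, ν x * ∑ a, |π x a - ρ x a| * l x a y ≤ R := by
    rw [Finset.sum_comm]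
    calc _ = ∑ x, ν x * ∑ a, |π x a - ρ x a| * ∑ y, l x a y := by
          apply Finset.sum_congr rfl
          intro x _
          rw [← Finset.mul_sum, Finset.sum_comm]
          simp only [Finset.mul_sum]
      _ ≤ ∑ x, ν x * R := by
          refine Finset.sum_le_sum fun x _ => mul_le_mul_of_nonneg_left ?_ (hν.1 x)
          simp only [hl1, mul_one]
          exact hR x
      _ = R := by
          rw [← Finset.sum_mul, hν.2, one_mul]
  have := Finset.sum_le_sum hpt
  rw [Finset.sum_add_distrib, Finset.sum_add_distrib] at this
  linarith

/-- accuracy of the soft-min MFCG fixed point, with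
L_p^tot = L_p^glob + L_p^loc, L_f^tot = L_f^glob + L_f^loc, φ = φ_max^tot − 1/δ:
‖μ*φ − μ̂‖₁ ≤ (2√|𝒜|δ(1−γ)/(L_f^tot + (γ/(1−γ))L_p^tot‖f‖∞))·exp(1 − δφ_max^tot) and
‖Q*_{μ*φ} − Q̂‖∞ ≤ 2√|𝒜|δ·exp(1 − δφ_max^tot). -/
theorem mfcg_accuracy [Fintype X] [Fintype A] [Nonempty X] [Nonempty A]
    (γ : ℝ) (hγ0 : 0 < γ) (hγ1 : γ < 1)
    (f : X → A → (X → ℝ) → (X → ℝ) → ℝ) (fnorm : ℝ)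
    (hf : ∀ x a μ μ', IsProb μ → IsProb μ' → |f x a μ μ'| ≤ fnorm)
    (p : X → A → (X → ℝ) → (X → ℝ) → X → ℝ)
    (hp0 : ∀ x a μ μ' x', IsProb μ → IsProb μ' → 0 ≤ p x a μ μ' x')
    (hp1 : ∀ x a μ μ', IsProb μ → IsProb μ' → ∑ x', p x a μ μ' x' = 1)
    (cmin : ℝ) (hcmin0 : 0 ≤ cmin)
    (hcmin : ∀ x a μ μ' x', IsProb μ → IsProb μ' → cmin ≤ p x a μ μ' x')
    (Lfglob Lfloc Lpglob Lploc : ℝ)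
    (hLfglob0 : 0 ≤ Lfglob) (hLfloc0 : 0 ≤ Lfloc) (hLpglob0 : 0 ≤ Lpglob) (hLploc0 : 0 ≤ Lploc)
    (hLfglob : ∀ x a μ μ₁ μ', IsProb μ → IsProb μ₁ → IsProb μ' →
      |f x a μ μ' - f x a μ₁ μ'| ≤ Lfglob * l1 (fun y => μ y - μ₁ y))
    (hLfloc : ∀ x a μ μ' μ'₁, IsProb μ → IsProb μ' → IsProb μ'₁ →
      |f x a μ μ' - f x a μ μ'₁| ≤ Lfloc * l1 (fun y => μ' y - μ'₁ y))
    (hLpglob : ∀ x a μ μ₁ μ', IsProb μ → IsProb μ₁ → IsProb μ' →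
      ∑ x', |p x a μ μ' x' - p x a μ₁ μ' x'| ≤ Lpglob * l1 (fun y => μ y - μ₁ y))
    (hLploc : ∀ x a μ μ' μ'₁, IsProb μ → IsProb μ' → IsProb μ'₁ →
      ∑ x', |p x a μ μ' x' - p x a μ μ'₁ x'| ≤ Lploc * l1 (fun y => μ' y - μ'₁ y))
    -- total constants
    (Lptot Lftot φmaxtot : ℝ)
    (hLptotdef : Lptot = Lpglob + Lploc) (hLftotdef : Lftot = Lfglob + Lfloc)
    (hLpc : Lptot < (Fintype.card X : ℝ) * cmin)
    (hφmaxtotdef : φmaxtot = ((Fintype.card X : ℝ) * cmin - Lptot) / (Fintype.card A : ℝ)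
        * ((1 - γ) / (Lftot + (γ / (1 - γ)) * Lptot * fnorm)))
    -- the fixed-point triple (μ̂, Q̂, μ̂')
    (μhat μhat' : X → ℝ) (Qhat : X → A → ℝ)
    (hμhat : IsProb μhat) (hμhat' : IsProb μhat')
    (hfixloc : Ppush3 p (fun x1 => argminE (Qhat x1)) μhat μhat' μhat' = μhat')
    (hfixQ : bell3 f p γ μhat μhat' Qhat = Qhat)
    (hfixglob : Ppush3 p (fun x1 => argminE (Qhat x1)) μhat μhat' μhat = μhat)
    -- δ is (a positive lower bound for) the action gap of Q̂
    (δ : ℝ) (hδ0 : 0 < δ)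
    (hgap : ∀ x a, minRow (Qhat x) < Qhat x a → minRow (Qhat x) + δ ≤ Qhat x a)
    (hφδ : 0 < φmaxtot - 1 / δ)
    -- the optimized smoothing parameter
    (φ : ℝ) (hφdef : φ = φmaxtot - 1 / δ)
    -- μ'*_{Q,μ} : the unique fixed point of μ' ↦ μ'P^{Q,μ,μ'}
    (mups : (X → A → ℝ) → (X → ℝ) → X → ℝ)
    (hmups : ∀ (Q : X → A → ℝ) (μ : X → ℝ), IsProb μ →
      IsProb (mups Q μ) ∧
        Ppush3 p (fun x1 => softmin φ (Q x1)) μ (mups Q μ) (mups Q μ) = mups Q μ)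
    -- Q*_μ : the unique fixed point of Q ↦ B_{μ,μ'*_{Q,μ}} Q in the ball
    (Qs : (X → ℝ) → X → A → ℝ)
    (hQs : ∀ μ : X → ℝ, IsProb μ → supQ (Qs μ) ≤ fnorm / (1 - γ) ∧
      bell3 f p γ μ (mups (Qs μ) μ) (Qs μ) = Qs μ)
    -- μ*φ : the unique fixed point of μ ↦ μP^{Q*_μ, μ, μ'*_{Q*_μ,μ}}
    (μstar : X → ℝ) (hμstar : IsProb μstar)
    (hμstarfix : Ppush3 p (fun x1 => softmin φ (Qs μstar x1)) μstar
        (mups (Qs μstar) μstar) μstar = μstar) :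
    l1 (fun x => μstar x - μhat x)
        ≤ 2 * Real.sqrt (Fintype.card A) * δ * (1 - γ)
            / (Lftot + (γ / (1 - γ)) * Lptot * fnorm) * Real.exp (1 - δ * φmaxtot)
    ∧ supQ (fun x a => Qs μstar x a - Qhat x a)
        ≤ 2 * Real.sqrt (Fintype.card A) * δ * Real.exp (1 - δ * φmaxtot) := by
  have hcpos : 0 < (Fintype.card X : ℝ) * cmin := by linarith
  obtain ⟨hmp, hmfix⟩ := hmups (Qs μstar) μstar hμstar
  have hmeq : mups (Qs μstar) μstar = μstar := by
    refine inv_unique' (fun x y => ∑ a, softmin φ (Qs μstar x) a *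
        p x a μstar (mups (Qs μstar) μstar) y) cmin ?_ ?_ hcpos _ _ hmp hμstar ?_ ?_
    · intro x y
      exact mixK_ge (X := X) _ (softmin_nonneg' _ _) (softmin_sum' _ _) _ _
        (fun a => hcmin _ _ _ _ _ hμstar hmp)
    · intro x
      exact mixK_sum _ (softmin_sum' _ _) (fun a => p x a μstar (mups (Qs μstar) μstar))
        (fun a => hp1 _ _ _ _ hμstar hmp)
    · intro y; exact congrFun hmfix y
    · intro y; exact congrFun hμstarfix y
  have hheq : μhat' = μhat := by
    refine inv_unique' (fun x y => ∑ a, argminE (Qhat x) a *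
        p x a μhat μhat' y) cmin ?_ ?_ hcpos _ _ hμhat' hμhat ?_ ?_
    · intro x y
      exact mixK_ge (X := X) _ (argminE_nonneg' _) (argminE_sum' _) _ _
        (fun a => hcmin _ _ _ _ _ hμhat hμhat')
    · intro x
      exact mixK_sum _ (argminE_sum' _) (fun a => p x a μhat μhat')
        (fun a => hp1 _ _ _ _ hμhat hμhat')
    · intro y; exact congrFun hfixloc y
    · intro y; exact congrFun hfixglob y
  obtain ⟨hQball, hQfix⟩ := hQs μstar hμstar
  rw [hmeq] at hQfix hμstarfix
  subst hheq
  clear hmfix hmp hmeq hfixloc hμhat'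
  generalize Qs μstar = Q at *
  obtain ⟨m, hm⟩ : ∃ m, m = l1 (fun x => μstar x - μhat' x) := ⟨_, rfl⟩
  have hm0 : 0 ≤ m := by rw [hm]; exact Finset.sum_nonneg fun _ _ => abs_nonneg _
  have x0 : X := Classical.arbitrary X
  have a0 : A := Classical.arbitrary A
  have hfn0 : 0 ≤ fnorm := le_trans (abs_nonneg _) (hf x0 a0 _ _ hμstar hμstar)
  have h1γ : 0 < 1 - γ := by linarith
  have hLp0 : 0 ≤ Lptot := by linarith
  have hLf0 : 0 ≤ Lftot := by linarith
  obtain ⟨D, hD⟩ : ∃ D, D = Lftot + (γ / (1 - γ)) * Lptot * fnorm := ⟨_, rfl⟩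
  have hD0 : 0 ≤ D := by rw [hD]; positivity
  have hDpos : 0 < D := by
    rcases hD0.lt_or_eq with h | h
    · exact h
    · exfalso
      rw [← hD, ← h] at hφmaxtotdef
      simp at hφmaxtotdef
      have : 0 < 1 / δ := by positivity
      linarith
  have hkl : ∀ x a, ∑ y, |p x a μstar μstar y - p x a μhat' μhat' y| ≤ Lptot * m := by
    intro x a
    have h1 := hLpglob x a μstar μhat' μstar hμstar hμhat hμstar
    have h2 := hLploc x a μhat' μstar μhat' hμhat hμstar hμhat
    rw [← hm] at h1 h2
    calc _ ≤ ∑ y, (|p x a μstar μstar y - p x a μhat' μstar y|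
          + |p x a μhat' μstar y - p x a μhat' μhat' y|) :=
          Finset.sum_le_sum fun y _ => abs_sub_le _ _ _
      _ ≤ _ := by rw [Finset.sum_add_distrib, hLptotdef]; linarith
  have hff : ∀ x a, |f x a μstar μstar - f x a μhat' μhat'| ≤ Lftot * m := by
    intro x a
    have h1 := hLfglob x a μstar μhat' μstar hμstar hμhat hμstar
    have h2 := hLfloc x a μhat' μstar μhat' hμhat hμstar hμhat
    rw [← hm] at h1 h2
    have := abs_sub_le (f x a μstar μstar) (f x a μhat' μstar) (f x a μhat' μhat')
    rw [hLftotdef]; linarith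
  have hQabs : ∀ x a, |Q x a| ≤ fnorm / (1 - γ) := fun x a =>
    le_trans (Finset.le_sup' (fun xa : X × A => |Q xa.1 xa.2|) (Finset.mem_univ (x, a))) hQball
  obtain ⟨M, hM⟩ : ∃ M, M = supQ (fun x a => Q x a - Qhat x a) := ⟨_, rfl⟩
  have hMle : ∀ x a, |Q x a - Qhat x a| ≤ M := fun x a => by
    rw [hM]
    exact Finset.le_sup' (fun xa : X × A => |Q xa.1 xa.2 - Qhat xa.1 xa.2|)
      (Finset.mem_univ (x, a))
  have hMb : M ≤ Lftot * m + γ * (Lptot * m * (fnorm / (1 - γ)) + M) := by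
    conv_lhs => rw [hM]
    unfold supQ
    apply Finset.sup'_le
    rintro ⟨x, a⟩ _
    have e1 := congrFun (congrFun hQfix x) a
    have e2 := congrFun (congrFun hfixQ x) a
    simp only [bell3] at e1 e2
    have e : Q x a - Qhat x a = (f x a μstar μstar - f x a μhat' μhat') +
        γ * (∑ y, (p x a μstar μstar y - p x a μhat' μhat' y) * minRow (Q y)
          + ∑ y, p x a μhat' μhat' y * (minRow (Q y) - minRow (Qhat y))) := by
      rw [← Finset.sum_add_distrib, ← e1, ← e2]
      have : ∀ y, (p x a μstar μstar y - p x a μhat' μhat' y) * minRow (Q y)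
          + p x a μhat' μhat' y * (minRow (Q y) - minRow (Qhat y))
          = p x a μstar μstar y * minRow (Q y) - p x a μhat' μhat' y * minRow (Qhat y) := by
        intro y; ring
      simp only [this, Finset.sum_sub_distrib]
      ring
    have b1 : |∑ y, (p x a μstar μstar y - p x a μhat' μhat' y) * minRow (Q y)|
        ≤ Lptot * m * (fnorm / (1 - γ)) := by
      refine (Finset.abs_sum_le_sum_abs _ _).trans ?_
      refine le_trans ?_ (mul_le_mul_of_nonneg_right (hkl x a) (by positivity))
      rw [Finset.sum_mul]
      refine Finset.sum_le_sum fun y _ => ?_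
      rw [abs_mul]
      exact mul_le_mul_of_nonneg_left (minRow_abs' _ _ (hQabs y)) (abs_nonneg _)
    have b2 : |∑ y, p x a μhat' μhat' y * (minRow (Q y) - minRow (Qhat y))| ≤ M := by
      refine (Finset.abs_sum_le_sum_abs _ _).trans ?_
      calc _ ≤ ∑ y, p x a μhat' μhat' y * M := by
            refine Finset.sum_le_sum fun y _ => ?_
            rw [abs_mul, abs_of_nonneg (hp0 _ _ _ _ _ hμhat hμhat)]
            exact mul_le_mul_of_nonneg_left (minRow_lip' _ _ _ (hMle y))
              (hp0 _ _ _ _ _ hμhat hμhat)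
        _ = M := by rw [← Finset.sum_mul, hp1 _ _ _ _ hμhat hμhat, one_mul]
    change |Q x a - Qhat x a| ≤ _
    rw [e]
    refine (abs_add_le _ _).trans (add_le_add (hff x a) ?_)
    rw [abs_mul, abs_of_pos hγ0]
    exact mul_le_mul_of_nonneg_left ((abs_add_le _ _).trans (add_le_add b1 b2)) hγ0.le
  have hMD : (1 - γ) * M ≤ D * m := by
    have : Lftot * m + γ * (Lptot * m * (fnorm / (1 - γ)) + M) = D * m + γ * M := by
      rw [hD]; field_simp; ring
    linarith
  have hMD' : M ≤ D * m / (1 - γ) := by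
    rw [le_div_iff₀ h1γ]; linarith
  have hφ0 : 0 < φ := by rw [hφdef]; exact hφδ
  have hn : (1 : ℝ) ≤ (Fintype.card A : ℝ) := by
    exact_mod_cast Fintype.card_pos
  obtain ⟨N, hN⟩ : ∃ N : ℝ, N = (Fintype.card A : ℝ) := ⟨_, rfl⟩
  obtain ⟨E, hE⟩ : ∃ E : ℝ, E = Real.exp (-(φ * δ)) := ⟨_, rfl⟩
  have hE0 : 0 < E := by rw [hE]; exact Real.exp_pos _
  have hR : ∀ x, ∑ a, |softmin φ (Q x) a - argminE (Qhat x) a| ≤ N * (φ * M) + 2 * N * E := by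
    intro x
    have h1 := softmin_lip' φ hφ0.le (Q x) (Qhat x) M (hMle x)
    have h2 := softmin_argmin' φ δ hφ0.le (Qhat x) (hgap x)
    rw [← hN] at h1 h2
    rw [← hE] at h2
    refine le_trans ?_ (add_le_add h1 h2)
    rw [← Finset.sum_add_distrib]
    exact Finset.sum_le_sum fun a _ => abs_sub_le _ _ _
  have hmain := inv_perturb' (fun x => softmin φ (Q x)) (fun x => argminE (Qhat x))
    (fun x a => p x a μstar μstar) (fun x a => p x a μhat' μhat')
    (fun x => softmin_nonneg' φ (Q x)) (fun x => softmin_sum' φ (Q x)) cmin (Lptot * m)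
    (N * (φ * M) + 2 * N * E) (fun x a y => hcmin _ _ _ _ _ hμstar hμstar)
    (fun x a => hp1 _ _ _ _ hμstar hμstar) (fun x a y => hp0 _ _ _ _ _ hμhat hμhat)
    (fun x a => hp1 _ _ _ _ hμhat hμhat) μstar μhat' hμstar hμhat hkl hR
    (fun y => congrFun hμstarfix y) (fun y => congrFun hfixglob y)
  change l1 (fun x => μstar x - μhat' x) ≤ _ * l1 (fun x => μstar x - μhat' x) + _ + _ at hmain
  rw [← hm] at hmain
  rw [← hm, ← hM, ← hD]
  rw [← hN, ← hD] at hφmaxtotdef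
  rw [← hN] at hn ⊢
  have hexp : Real.exp (1 - δ * φmaxtot) = E := by
    rw [hE, hφdef]; congr 1; field_simp; ring
  rw [hexp]
  have hN0 : 0 < N := by linarith
  have hsq : 1 ≤ Real.sqrt N := Real.one_le_sqrt.mpr hn
  have hcl : (Fintype.card X : ℝ) * cmin - Lptot = φmaxtot * N * D / (1 - γ) := by
    rw [hφmaxtotdef]; field_simp
  have hmb : m ≤ 2 * δ * (1 - γ) / D * E := by
    have k1 : ((Fintype.card X : ℝ) * cmin - Lptot) * m ≤ N * (φ * (D * m / (1 - γ))) + 2 * N * E := by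
      have : N * (φ * M) ≤ N * (φ * (D * m / (1 - γ))) :=
        mul_le_mul_of_nonneg_left (mul_le_mul_of_nonneg_left hMD' hφ0.le) hN0.le
      linarith
    rw [hcl] at k1
    have k2 : φmaxtot * N * D / (1 - γ) * m - N * (φ * (D * m / (1 - γ)))
        = N * (D * m / (δ * (1 - γ))) := by
      rw [hφdef]; field_simp; ring
    have k3 : N * (D * m / (δ * (1 - γ))) ≤ N * (2 * E) := by linarith
    have k4 := le_of_mul_le_mul_left k3 hN0
    rw [div_le_iff₀ (by positivity)] at k4
    have : 2 * δ * (1 - γ) / D * E = (2 * E * (δ * (1 - γ))) / D := by ring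
    rw [this, le_div_iff₀ hDpos]
    linarith
  have hmb2 : m ≤ 2 * Real.sqrt N * δ * (1 - γ) / D * E := by
    have h0 : 0 ≤ 2 * δ * (1 - γ) / D * E := by positivity
    have : 2 * Real.sqrt N * δ * (1 - γ) / D * E = Real.sqrt N * (2 * δ * (1 - γ) / D * E) := by ring
    rw [this]
    nlinarith
  refine ⟨hmb2, hMD'.trans ?_⟩
  rw [div_le_iff₀ h1γ]
  calc D * m ≤ D * (2 * Real.sqrt N * δ * (1 - γ) / D * E) :=
        mul_le_mul_of_nonneg_left hmb2 hD0
    _ = _ := by field_simp
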